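/- arXiv:2507.13804 — 2 statements merged into one kernel-verified Lean document; each statement's English description precedes it below -/
import Mathlib

section
/- Let f : ℝⁿ → ℝ be C² and let α > 0 be a fixed step size. If the set Σ = { x ∈ ℝⁿ : 1/α is an eigenvalue of the Hessian ∇²f(x) } has Lebesgue measure zero, then gradient descent with constant step size α avoids the strict saddles of f: the set of initial points x₀ ∈ ℝⁿ such that the sequence defined by x_{t+1} = x_t − α∇f(x_t) converges to a strict saddle of f has Lebesgue measure zero. (In particular, no assumption is needed that Σ contains no strict saddle, nor that ∇f is Lipschitz.) -/
open MeasureTheory Filter Topology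

noncomputable section

/-- A strict saddle of a `C²` function `f : ℝⁿ → ℝ`: the gradient vanishes and the Hessian
(the derivative of the gradient) has a negative eigenvalue. -/
def IsStrictSaddle {n : ℕ} (f : EuclideanSpace ℝ (Fin n) → ℝ)
    (p : EuclideanSpace ℝ (Fin n)) : Prop :=
  gradient f p = 0 ∧
    ∃ μ : ℝ, μ < 0 ∧ ∃ v : EuclideanSpace ℝ (Fin n), v ≠ 0 ∧
      fderiv ℝ (gradient f) p v = μ • v

section helpers

variable {E : Type*} [NormedAddCommGroup E] [InnerProductSpace ℝ E] [FiniteDimensional ℝ E]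
  [MeasurableSpace E] [BorelSpace E]

/-- Preimages of null sets under a `C¹` map with a.e. invertible derivative are null. -/
theorem null_preimage_of_ae_invertible {g : E → E} (hg : ContDiff ℝ 1 g)
    (hS : volume {x : E | ∃ v : E, v ≠ 0 ∧ fderiv ℝ g x v = 0} = 0)
    {N : Set E} (hN : volume N = 0) : volume (g ⁻¹' N) = 0 := by
  obtain ⟨N', hNN', hN'm, hN'⟩ := exists_measurable_superset_of_null hN
  have hdetc : Continuous fun x => (fderiv ℝ g x).det :=
    ContinuousLinearMap.continuous_det.comp (hg.continuous_fderiv one_ne_zero)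
  set S : Set E := {x : E | ∃ v : E, v ≠ 0 ∧ fderiv ℝ g x v = 0} with hSdef
  have hker : ∀ x, x ∉ S → (fderiv ℝ g x).det ≠ 0 := by
    intro x hx hdet
    have := LinearMap.bot_lt_ker_of_det_eq_zero (f := (fderiv ℝ g x : E →ₗ[ℝ] E)) hdet
    obtain ⟨v, hv, hv0⟩ := (Submodule.ne_bot_iff _).1 this.ne'
    exact hx ⟨v, hv0, by simpa using hv⟩
  have hmain : volume (g ⁻¹' N' \ S) = 0 := by
    refine measure_null_of_locally_null _ fun x hx => ?_
    have hdx := hker x hx.2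
    let e : E ≃L[ℝ] E := (fderiv ℝ g x).toContinuousLinearEquivOfDetNeZero hdx
    have he : (e : E →L[ℝ] E) = fderiv ℝ g x := by ext; simp [e]
    have hst : HasStrictFDerivAt g (e : E →L[ℝ] E) x := by
      rw [he]; exact hg.contDiffAt.hasStrictFDerivAt one_ne_zero
    set P := hst.toOpenPartialHomeomorph g with hP
    have hxP : x ∈ P.source := hst.mem_toOpenPartialHomeomorph_source
    have hinj : Set.InjOn g P.source := by
      have := P.injOn
      rwa [hP, hst.toOpenPartialHomeomorph_coe] at this
    have hO : IsOpen {y : E | (fderiv ℝ g y).det ≠ 0} := isOpen_ne_fun hdetc continuous_const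
    set u : Set E := (P.source ∩ {y : E | (fderiv ℝ g y).det ≠ 0}) ∩ g ⁻¹' N' with hu
    have hum : MeasurableSet u :=
      (P.open_source.inter hO).measurableSet.inter (hg.continuous.measurable hN'm)
    refine ⟨u, ?_, ?_⟩
    · have h1 : P.source ∩ {y : E | (fderiv ℝ g y).det ≠ 0} ∈ 𝓝 x :=
        (P.open_source.inter hO).mem_nhds ⟨hxP, hdx⟩
      refine inter_mem (mem_nhdsWithin_of_mem_nhds h1) ?_
      exact mem_of_superset self_mem_nhdsWithin fun y hy => hy.1
    · have hJac := lintegral_abs_det_fderiv_eq_addHaar_image volume hum (f := g)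
        (f' := fderiv ℝ g)
        (fun y _ => ((hg.differentiable one_ne_zero) y).hasFDerivAt.hasFDerivWithinAt)
        (hinj.mono fun y hy => hy.1.1)
      have him : volume (g '' u) = 0 :=
        measure_mono_null (by rintro _ ⟨y, hy, rfl⟩; exact hy.2) hN'
      rw [him, lintegral_eq_zero_iff
        (show Measurable fun y => ENNReal.ofReal |(fderiv ℝ g y).det| from
          ENNReal.measurable_ofReal.comp hdetc.abs.measurable), Filter.EventuallyEq,
        ae_restrict_iff' hum] at hJac
      rw [measure_eq_zero_iff_ae_notMem]
      filter_upwards [hJac] with y hy hyu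
      have h2 := hy hyu
      simp only [Pi.zero_apply, ENNReal.ofReal_eq_zero] at h2
      exact hyu.1.2 (abs_eq_zero.1 (le_antisymm h2 (abs_nonneg _)))
  refine measure_mono_null (t := (g ⁻¹' N' \ S) ∪ S) ?_ (measure_union_null hmain hS)
  intro y hy
  by_cases hyS : y ∈ S
  · exact Or.inr hyS
  · exact Or.inl ⟨hNN' hy, hyS⟩

/-- Local statement: near a fixed point with symmetric derivative having an eigenvalue `> 1`,
the points whose whole orbit stays in a small closed ball form a null set. -/
theorem exists_radius_null_trapped {g : E → E} (hg : ContDiff ℝ 1 g) (p : E)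
    (hsymm : ∀ x y : E, inner ℝ (fderiv ℝ g p x) y = inner ℝ x (fderiv ℝ g p y))
    {l : ℝ} (hl : 1 < l) {v : E} (hv : v ≠ 0) (hAv : fderiv ℝ g p v = l • v) :
    ∃ r > 0, volume {x : E | ∀ t : ℕ, g^[t] x ∈ Metric.closedBall p r} = 0 := by
  set A := fderiv ℝ g p with hA
  -- choice of the threshold `c`
  obtain ⟨c, ⟨hc1, hcl⟩, hcne⟩ : ∃ c ∈ Set.Ioo 1 (l ^ 2),
      ¬ Module.End.HasEigenvalue ((A ∘L A : E →L[ℝ] E) : E →ₗ[ℝ] E) c := by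
    have h := ((Set.Ioo_infinite (show (1 : ℝ) < l ^ 2 by nlinarith)).sdiff
      (Module.End.finite_hasEigenvalue ((A ∘L A : E →L[ℝ] E) : E →ₗ[ℝ] E))).nonempty
    obtain ⟨c, hc, hc'⟩ := h
    exact ⟨c, hc, hc'⟩
  -- the lower bound for `A² - c`
  obtain ⟨b, hb, hB⟩ : ∃ b : ℝ, 0 < b ∧ ∀ z : E, b * ‖z‖ ≤ ‖A (A z) - c • z‖ := by
    have hk : LinearMap.ker (((A ∘L A : E →L[ℝ] E) : E →ₗ[ℝ] E) - c • LinearMap.id) = ⊥ := by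
      rw [LinearMap.ker_eq_bot']
      intro z hz
      by_contra hz0
      refine hcne (Module.End.hasEigenvalue_of_hasEigenvector (x := z)
        ⟨Module.End.mem_eigenspace_iff.2 ?_, hz0⟩)
      have : A (A z) - c • z = 0 := by simpa using hz
      simpa using sub_eq_zero.1 this
    obtain ⟨K, hK, hKA⟩ := LinearMap.exists_antilipschitzWith _ hk
    refine ⟨(K : ℝ)⁻¹, by positivity, fun z => ?_⟩
    have h := hKA.le_mul_dist z 0
    rw [map_zero, dist_zero_right, dist_zero_right] at h
    have hK' : (0 : ℝ) < K := hK
    rw [inv_mul_le_iff₀ hK']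
    simpa using h
  set M := ‖A‖ with hM
  have hM0 : 0 ≤ M := norm_nonneg _
  set Q : E → ℝ := fun z => ‖A z‖ ^ 2 - c * ‖z‖ ^ 2 with hQ
  have hQA : ∀ z, Q (A z) = ‖A (A z) - c • z‖ ^ 2 + c * Q z := by
    intro z
    have h1 : inner ℝ (A (A z)) z = ‖A z‖ ^ 2 := by
      rw [hsymm, real_inner_self_eq_norm_sq]
    simp only [hQ]
    rw [norm_sub_sq_real, inner_smul_right, h1, norm_smul, mul_pow, Real.norm_eq_abs, sq_abs]
    ring
  set K : ℝ := 2 * M ^ 3 + 2 * c * M + c with hKdef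
  have hKpos : 0 < K := by positivity
  have hpert : ∀ (ε : ℝ), 0 ≤ ε → ε ≤ 1 → ∀ z e : E, ‖e‖ ≤ ε * ‖z‖ →
      Q (A z) - ε * K * ‖z‖ ^ 2 ≤ Q (A z + e) := by
    intro ε h0 h1 z e he
    simp only [hQ, map_add]
    rw [norm_add_sq_real (A (A z)) (A e), norm_add_sq_real (A z) e]
    have hAz : ‖A z‖ ≤ M * ‖z‖ := A.le_opNorm z
    have hAAz : ‖A (A z)‖ ≤ M * (M * ‖z‖) :=
      (A.le_opNorm _).trans (mul_le_mul_of_nonneg_left hAz hM0)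
    have hAe : ‖A e‖ ≤ M * (ε * ‖z‖) :=
      (A.le_opNorm _).trans (mul_le_mul_of_nonneg_left he hM0)
    have i1 : -((M * (M * ‖z‖)) * (M * (ε * ‖z‖))) ≤ inner ℝ (A (A z)) (A e) := by
      have := (abs_le.1 (abs_real_inner_le_norm (A (A z)) (A e))).1
      have h3 : ‖A (A z)‖ * ‖A e‖ ≤ (M * (M * ‖z‖)) * (M * (ε * ‖z‖)) := by gcongr
      linarith
    have i2 : inner ℝ (A z) e ≤ (M * ‖z‖) * (ε * ‖z‖) := by
      refine (real_inner_le_norm _ _).trans ?_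
      gcongr
    have i3 : ‖e‖ ^ 2 ≤ ε * ‖z‖ ^ 2 := by
      have : ‖e‖ ^ 2 ≤ (ε * ‖z‖) ^ 2 := by gcongr
      have h4 : ε * ε * ‖z‖ ^ 2 ≤ ε * 1 * ‖z‖ ^ 2 := by gcongr
      nlinarith
    have i4 : c * inner ℝ (A z) e ≤ c * ((M * ‖z‖) * (ε * ‖z‖)) := by gcongr
    have i5 : c * ‖e‖ ^ 2 ≤ c * (ε * ‖z‖ ^ 2) := by gcongr
    have i6 : 0 ≤ ‖A e‖ ^ 2 := by positivity
    rw [hKdef]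
    nlinarith
  set ε : ℝ := min 1 (b ^ 2 / K) with hε
  have hε0 : 0 < ε := lt_min one_pos (by positivity)
  have hε1 : ε ≤ 1 := min_le_left _ _
  have hεK : ε * K ≤ b ^ 2 := by
    have : ε ≤ b ^ 2 / K := min_le_right _ _
    rwa [le_div_iff₀ hKpos] at this
  obtain ⟨s, hs, hsA⟩ := (hg.contDiffAt.hasStrictFDerivAt one_ne_zero :
    HasStrictFDerivAt g A p).approximates_deriv_on_nhds (c := ⟨ε, hε0.le⟩) (Or.inr hε0)
  obtain ⟨r, hr, hrs⟩ := Metric.nhds_basis_closedBall.mem_iff.1 hs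
  have hstep : ∀ x ∈ Metric.closedBall p r, ∀ y ∈ Metric.closedBall p r,
      c * Q (x - y) ≤ Q (g x - g y) := by
    intro x hx y hy
    have h := hpert ε hε0.le hε1 (x - y) (g x - g y - A (x - y)) (hsA x (hrs hx) y (hrs hy))
    rw [add_sub_cancel, hQA] at h
    have h2 : (b * ‖x - y‖) ^ 2 ≤ ‖A (A (x - y)) - c • (x - y)‖ ^ 2 := by
      have := hB (x - y)
      gcongr
    have h3 : ε * K * ‖x - y‖ ^ 2 ≤ b ^ 2 * ‖x - y‖ ^ 2 := by gcongr
    nlinarith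
  refine ⟨r, hr, ?_⟩
  set W : Set E := {x : E | ∀ t : ℕ, g^[t] x ∈ Metric.closedBall p r} with hW
  have hWneg : ∀ x ∈ W, ∀ y ∈ W, Q (x - y) ≤ 0 := by
    intro x hx y hy
    by_contra! hpos
    have hiter : ∀ t : ℕ, c ^ t * Q (x - y) ≤ Q (g^[t] x - g^[t] y) := by
      intro t
      induction t with
      | zero => simp
      | succ t ih =>
        rw [Function.iterate_succ_apply', Function.iterate_succ_apply']
        refine le_trans ?_ (hstep _ (hx t) _ (hy t))
        rw [pow_succ', mul_assoc]
        gcongr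
    have hbd : ∀ t : ℕ, Q (g^[t] x - g^[t] y) ≤ (M * (r + r)) ^ 2 := by
      intro t
      have h1 : ‖g^[t] x - g^[t] y‖ ≤ r + r := by
        rw [← dist_eq_norm]
        exact (dist_triangle_right _ _ p).trans
          (add_le_add (Metric.mem_closedBall.1 (hx t)) (Metric.mem_closedBall.1 (hy t)))
      have h2 : ‖A (g^[t] x - g^[t] y)‖ ≤ M * (r + r) :=
        (A.le_opNorm _).trans (mul_le_mul_of_nonneg_left h1 hM0)
      have h3 : ‖A (g^[t] x - g^[t] y)‖ ^ 2 ≤ (M * (r + r)) ^ 2 := by gcongr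
      have h4 : 0 ≤ c * ‖g^[t] x - g^[t] y‖ ^ 2 := by positivity
      simp only [hQ]
      linarith
    obtain ⟨t, ht⟩ := pow_unbounded_of_one_lt ((M * (r + r)) ^ 2 / Q (x - y)) hc1
    rw [div_lt_iff₀ hpos] at ht
    exact absurd ((hiter t).trans (hbd t)) (not_le.2 ht)
  have hWc : IsClosed W := by
    have : W = ⋂ t : ℕ, g^[t] ⁻¹' Metric.closedBall p r := by ext; simp [hW]
    rw [this]
    exact isClosed_iInter fun t => Metric.isClosed_closedBall.preimage (hg.continuous.iterate t)
  have hQv : ∀ a : ℝ, a ≠ 0 → 0 < Q (a • v) := by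
    intro a ha
    simp only [hQ, map_smul, hAv, norm_smul, mul_pow, Real.norm_eq_abs, sq_abs]
    have h1 : 0 < a ^ 2 * ‖v‖ ^ 2 := by positivity
    nlinarith [mul_pos h1 (sub_pos.2 hcl)]
  refine Measure.addHaar_eq_zero_of_disjoint_translates volume
    (fun k : ℕ => (1 / ((k : ℝ) + 1)) • v) ?_ ?_ hWc.measurableSet
  · refine (Metric.isBounded_closedBall (x := (0 : E)) (r := ‖v‖)).subset ?_
    rintro _ ⟨k, rfl⟩
    rw [mem_closedBall_zero_iff, norm_smul]
    refine mul_le_of_le_one_left (norm_nonneg _) ?_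
    rw [Real.norm_of_nonneg (by positivity), div_le_one (by positivity)]
    linarith [(Nat.cast_nonneg k : (0 : ℝ) ≤ k)]
  · intro i j hij
    rw [Function.onFun, Set.disjoint_left]
    intro w hwi hwj
    rw [Set.singleton_add] at hwi hwj
    obtain ⟨x, hx, hxw⟩ := hwi
    obtain ⟨y, hy, hyw⟩ := hwj
    have hd : x - y = (1 / ((j : ℝ) + 1) - 1 / ((i : ℝ) + 1)) • v := by
      simp only at hxw hyw
      rw [sub_smul, eq_sub_of_add_eq' hxw, eq_sub_of_add_eq' hyw]
      abel
    have hne : (1 / ((j : ℝ) + 1) - 1 / ((i : ℝ) + 1)) ≠ 0 := by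
      intro h0
      rw [sub_eq_zero, one_div, one_div, inv_inj] at h0
      exact hij (by exact_mod_cast (add_right_cancel h0).symm)
    have := hWneg x hx y hy
    rw [hd] at this
    exact absurd this (not_le.2 (hQv _ hne))

end helpers

/-- For a `C²` function `f : ℝⁿ → ℝ` and a fixed step size `α > 0`, if the set of points
where `1/α` is an eigenvalue of the Hessian `∇²f(x)` has Lebesgue measure zero, then
gradient descent with step size `α` avoids the strict saddles of `f`. -/
theorem gd_avoids_strict_saddles_of_sigma_null {n : ℕ}
    (f : EuclideanSpace ℝ (Fin n) → ℝ) (hf : ContDiff ℝ 2 f)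
    (α : ℝ) (hα : 0 < α)
    (hSigma : volume {x : EuclideanSpace ℝ (Fin n) |
      ∃ v : EuclideanSpace ℝ (Fin n), v ≠ 0 ∧
        fderiv ℝ (gradient f) x v = (1 / α) • v} = 0) :
    volume {x₀ : EuclideanSpace ℝ (Fin n) |
      ∃ p, IsStrictSaddle f p ∧
        Tendsto (fun t => (fun x => x - α • gradient f x)^[t] x₀) atTop (𝓝 p)} = 0 := by
  let L : (EuclideanSpace ℝ (Fin n) →L[ℝ] ℝ) ≃ₗᵢ[ℝ] EuclideanSpace ℝ (Fin n) :=
    (InnerProductSpace.toDual ℝ (EuclideanSpace ℝ (Fin n))).symm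
  let L' : (EuclideanSpace ℝ (Fin n) →L[ℝ] ℝ) →L[ℝ] EuclideanSpace ℝ (Fin n) :=
    (L.toContinuousLinearEquiv : _ →L[ℝ] _)
  have hdf : ContDiff ℝ 1 (fderiv ℝ f) := hf.fderiv_right (by norm_num)
  have hgrad : ContDiff ℝ 1 (gradient f) := L.contDiff.comp hdf
  have hgd : Differentiable ℝ (gradient f) := hgrad.differentiable one_ne_zero
  have hinner : ∀ p x y, inner ℝ (fderiv ℝ (gradient f) p x) y =
      fderiv ℝ (fderiv ℝ f) p x y := by
    intro p x y
    have h1 : HasFDerivAt (gradient f)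
        (L' ∘L fderiv ℝ (fderiv ℝ f) p) p :=
      L'.hasFDerivAt.comp p
        (hdf.differentiable one_ne_zero p).hasFDerivAt
    rw [h1.fderiv]
    exact InnerProductSpace.toDual_symm_apply
  have hHsymm : ∀ p x y, inner ℝ (fderiv ℝ (gradient f) p x) y =
      inner ℝ x (fderiv ℝ (gradient f) p y) := by
    intro p x y
    rw [hinner, real_inner_comm, hinner]
    exact (hf.contDiffAt.isSymmSndFDerivAt (by simp)) x y
  set g : EuclideanSpace ℝ (Fin n) → EuclideanSpace ℝ (Fin n) :=
    fun x => x - α • gradient f x with hgdef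
  have hg : ContDiff ℝ 1 g := contDiff_id.sub (hgrad.const_smul α)
  have hDg : ∀ p x, fderiv ℝ g p x = x - α • fderiv ℝ (gradient f) p x := by
    intro p x
    have h1 : HasFDerivAt g (ContinuousLinearMap.id ℝ _ - α • fderiv ℝ (gradient f) p) p :=
      (hasFDerivAt_id p).sub ((hgd p).hasFDerivAt.const_smul α)
    rw [h1.fderiv]
    simp
  have hS : volume {x : EuclideanSpace ℝ (Fin n) |
      ∃ v : EuclideanSpace ℝ (Fin n), v ≠ 0 ∧ fderiv ℝ g x v = 0} = 0 := by
    refine measure_mono_null ?_ hSigma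
    rintro x ⟨v, hv, hv0⟩
    refine ⟨v, hv, ?_⟩
    rw [hDg, sub_eq_zero] at hv0
    rw [one_div, eq_inv_smul_iff₀ hα.ne']
    exact hv0.symm
  have hiter : ∀ (t : ℕ) (N : Set (EuclideanSpace ℝ (Fin n))), volume N = 0 →
      volume (g^[t] ⁻¹' N) = 0 := by
    intro t
    induction t with
    | zero => intro N hN; simpa using hN
    | succ t ih =>
      intro N hN
      rw [Function.iterate_succ', Set.preimage_comp]
      exact ih _ (null_preimage_of_ae_invertible hg hS hN)
  have hloc : ∀ p, IsStrictSaddle f p → ∃ r > 0,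
      volume {x | ∀ t : ℕ, g^[t] x ∈ Metric.closedBall p r} = 0 := by
    rintro p ⟨-, μ, hμ, v, hv, hv'⟩
    refine exists_radius_null_trapped hg p ?_ (l := 1 - α * μ) (by nlinarith) hv ?_
    · intro x y
      rw [hDg, hDg, inner_sub_left, inner_sub_right, real_inner_smul_left,
        real_inner_smul_right, hHsymm]
    · rw [hDg, hv', sub_smul, one_smul, smul_smul]
  choose! r hr hr0 using hloc
  obtain ⟨C, hCs, hC, hCcov⟩ := TopologicalSpace.countable_cover_nhdsWithin
    (s := {p | IsStrictSaddle f p}) (f := fun p => Metric.ball p (r p))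
    (fun p hp => mem_nhdsWithin_of_mem_nhds (Metric.ball_mem_nhds p (hr p hp)))
  refine measure_mono_null (t := ⋃ p ∈ C, ⋃ t : ℕ,
    g^[t] ⁻¹' {x | ∀ t : ℕ, g^[t] x ∈ Metric.closedBall p (r p)}) ?_ ?_
  · rintro x₀ ⟨p, hp, hlim⟩
    obtain ⟨q, hqC, hpq⟩ := Set.mem_iUnion₂.1 (hCcov hp)
    have hev := hlim.eventually (Metric.isOpen_ball.mem_nhds hpq)
    obtain ⟨T, hT⟩ := eventually_atTop.1 hev
    refine Set.mem_iUnion₂.2 ⟨q, hqC, Set.mem_iUnion.2 ⟨T, fun t => ?_⟩⟩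
    rw [← Function.iterate_add_apply]
    exact Metric.ball_subset_closedBall (hT (t + T) (Nat.le_add_left _ _))
  · rw [measure_biUnion_null_iff hC]
    intro q hq
    rw [measure_iUnion_null_iff]
    exact fun t => hiter t _ (hr0 q (hCs hq))
end
end

section
/- Let f : ℝⁿ → ℝ be C² and let τ, r ∈ (0,1). Then for almost every initial step size ᾱ > 0, stabilized Armijo backtracking gradient descent avoids the strict saddles of f: the set of initial points x₀ ∈ ℝⁿ such that the generated sequence (x_t) converges to a strict saddle of f has Lebesgue measure zero. No global Lipschitz assumption on ∇f is made and ᾱ may be arbitrarily large. -/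
open MeasureTheory Filter Topology

noncomputable section

/-- The Armijo sufficient decrease condition for `f` at point `x` with step size `α` and
tolerance `r`. -/
def ArmijoCond {n : ℕ} (f : EuclideanSpace ℝ (Fin n) → ℝ) (r : ℝ)
    (x : EuclideanSpace ℝ (Fin n)) (α : ℝ) : Prop :=
  r * α * ‖gradient f x‖ ^ 2 ≤ f x - f (x - α • gradient f x)

/-- The sequences `(x_t)` and `(α_t)` are generated by stabilized Armijo backtracking
gradient descent with parameters `τ, r`, initial step size `abar` and initial point `x 0`.
Here `a t` denotes `α_{t−1}`, so `a 0 = ᾱ = abar`, and at iteration `t` the accepted step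
size is `a (t+1) = τ^k * a t` with `k` the smallest nonnegative integer such that the
Armijo condition holds. -/
def StabilizedArmijo {n : ℕ} (f : EuclideanSpace ℝ (Fin n) → ℝ) (τ r abar : ℝ)
    (x : ℕ → EuclideanSpace ℝ (Fin n)) (a : ℕ → ℝ) : Prop :=
  a 0 = abar ∧
  ∀ t : ℕ, ∃ k : ℕ,
    a (t + 1) = τ ^ k * a t ∧
    ArmijoCond f r (x t) (τ ^ k * a t) ∧
    (∀ j < k, ¬ ArmijoCond f r (x t) (τ ^ j * a t)) ∧
    x (t + 1) = x t - a (t + 1) • gradient f (x t)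

section Helpers

variable {E : Type*} [NormedAddCommGroup E] [InnerProductSpace ℝ E] [FiniteDimensional ℝ E]

/-- The set of eigenvalues of an operator in finite dimension is finite. -/
lemma finite_eigs (L : E →L[ℝ] E) : {s : ℝ | ∃ v : E, v ≠ 0 ∧ L v = s • v}.Finite := by
  refine (Module.End.finite_hasEigenvalue (L : E →ₗ[ℝ] E)).subset ?_
  rintro s ⟨v, hv, h⟩
  exact Module.End.hasEigenvalue_of_hasEigenvector
    (Module.End.hasEigenvector_iff.2 ⟨Module.End.mem_eigenspace_iff.2 h, hv⟩)

lemma exists_ker_of_det (L : E →L[ℝ] E) (h : L.det = 0) : ∃ v : E, v ≠ 0 ∧ L v = 0 := by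
  have h2 := LinearMap.bot_lt_ker_of_det_eq_zero (f := (L : E →ₗ[ℝ] E)) h
  obtain ⟨v, hv, hv0⟩ := Submodule.exists_mem_ne_zero_of_ne_bot h2.ne'
  exact ⟨v, hv0, by simpa using hv⟩

/-- One-step growth of the quadratic form `Q w = ‖A w‖² - σ ‖w‖²`. -/
lemma exists_growth (A : E →L[ℝ] E) (hA : ∀ x y, inner ℝ (A x) y = inner ℝ x (A y))
    (l : ℝ) (hl : 1 < l) :
    ∃ σ : ℝ, 1 < σ ∧ σ < l ^ 2 ∧ ∃ ε : ℝ, 0 < ε ∧ ∀ w e : E, ‖e‖ ≤ ε * ‖w‖ →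
      σ * (‖A w‖ ^ 2 - σ * ‖w‖ ^ 2) ≤ ‖A (A w + e)‖ ^ 2 - σ * ‖A w + e‖ ^ 2 := by
  have hl2 : 1 < l ^ 2 := by nlinarith
  have hinf : (Set.Ioo 1 (l ^ 2)).Infinite := Set.Ioo_infinite hl2
  obtain ⟨σ, hσ, hσ'⟩ := (hinf.sdiff (finite_eigs (A ∘L A))).nonempty
  refine ⟨σ, hσ.1, hσ.2, ?_⟩
  have h1σ := hσ.1
  let B : E →ₗ[ℝ] E := ((A ∘L A - σ • ContinuousLinearMap.id ℝ E : E →L[ℝ] E) : E →ₗ[ℝ] E)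
  have hBdef : ∀ w, B w = A (A w) - σ • w := fun w => by simp [B]
  have hB : LinearMap.ker B = ⊥ := by
    rw [LinearMap.ker_eq_bot']
    intro m hm
    by_contra hne
    refine hσ' ⟨m, hne, ?_⟩
    rw [hBdef] at hm
    simpa using sub_eq_zero.1 hm
  obtain ⟨K, hK, hKB⟩ := (LinearMap.injective_iff_antilipschitz B).1 (LinearMap.ker_eq_bot.1 hB)
  have hK' : (0 : ℝ) < K := hK
  have hlow : ∀ w, ‖w‖ ≤ K * ‖B w‖ := fun w => by
    simpa using hKB.le_mul_dist w 0
  set M := ‖A‖ with hM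
  have hM0 : 0 ≤ M := norm_nonneg _
  set C := 2 * M ^ 3 + 2 * σ * M + σ with hC
  have hCpos : 0 < C := by positivity
  set c := 1 / (K : ℝ) ^ 2 with hc
  have hcpos : 0 < c := by positivity
  refine ⟨min 1 (c / C), lt_min one_pos (by positivity), fun w e he => ?_⟩
  set ε := min 1 (c / C)
  have hε1 : ε ≤ 1 := min_le_left _ _
  have hε0 : 0 < ε := lt_min one_pos (by positivity)
  have hεC : ε * C ≤ c := by
    have : ε ≤ c / C := min_le_right _ _
    rwa [le_div_iff₀ hCpos] at this
  have hBw : c * ‖w‖ ^ 2 ≤ ‖B w‖ ^ 2 := by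
    have h1 : ‖w‖ ^ 2 ≤ (K * ‖B w‖) ^ 2 := by
      have := hlow w
      gcongr
    rw [hc, one_div, inv_mul_le_iff₀ (by positivity)]
    nlinarith
  have hBexp : ‖B w‖ ^ 2 = ‖A (A w)‖ ^ 2 - 2 * σ * ‖A w‖ ^ 2 + σ ^ 2 * ‖w‖ ^ 2 := by
    rw [hBdef, norm_sub_sq_real, inner_smul_right, hA, real_inner_self_eq_norm_sq, norm_smul,
      mul_pow, Real.norm_eq_abs, sq_abs]
    ring
  have hw0 := norm_nonneg w
  have hAw : ‖A w‖ ≤ M * ‖w‖ := A.le_opNorm w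
  have hAAw : ‖A (A w)‖ ≤ M ^ 2 * ‖w‖ := by
    calc ‖A (A w)‖ ≤ M * ‖A w‖ := A.le_opNorm _
      _ ≤ M * (M * ‖w‖) := by gcongr
      _ = _ := by ring
  have hAe : ‖A e‖ ≤ M * (ε * ‖w‖) := by
    calc ‖A e‖ ≤ M * ‖e‖ := A.le_opNorm _
      _ ≤ _ := by gcongr
  have h1 : ‖A (A w)‖ ^ 2 - 2 * M ^ 3 * ε * ‖w‖ ^ 2 ≤ ‖A (A w + e)‖ ^ 2 := by
    rw [map_add, norm_add_sq_real]
    have h2 : |inner ℝ (A (A w)) (A e)| ≤ ‖A (A w)‖ * ‖A e‖ := abs_real_inner_le_norm _ _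
    have h3 : ‖A (A w)‖ * ‖A e‖ ≤ (M ^ 2 * ‖w‖) * (M * (ε * ‖w‖)) := by gcongr
    have h4 := (abs_le.1 h2).1
    nlinarith [sq_nonneg ‖A e‖]
  have h2 : ‖A w + e‖ ^ 2 ≤ ‖A w‖ ^ 2 + 2 * M * ε * ‖w‖ ^ 2 + ε * ‖w‖ ^ 2 := by
    rw [norm_add_sq_real]
    have h2 : inner ℝ (A w) e ≤ ‖A w‖ * ‖e‖ := real_inner_le_norm _ _
    have h3 : ‖A w‖ * ‖e‖ ≤ (M * ‖w‖) * (ε * ‖w‖) := by gcongr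
    have h4 : ‖e‖ ^ 2 ≤ (ε * ‖w‖) ^ 2 := by gcongr
    have h5 : (ε * ‖w‖) ^ 2 ≤ ε * ‖w‖ ^ 2 := by
      rw [mul_pow]
      gcongr
      nlinarith
    nlinarith
  have h3 : σ * ‖A w + e‖ ^ 2 ≤ σ * (‖A w‖ ^ 2 + 2 * M * ε * ‖w‖ ^ 2 + ε * ‖w‖ ^ 2) := by
    gcongr
  have h4 : ε * C * ‖w‖ ^ 2 ≤ c * ‖w‖ ^ 2 := by gcongr
  rw [hC] at h4
  nlinarith

variable [MeasurableSpace E] [BorelSpace E]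

/-- Points whose whole forward orbit stays near an unstable fixed point form a null set. -/
lemma exists_null_local (μ : Measure E) [μ.IsAddHaarMeasure] (g : E → E) (hg : Continuous g)
    (p : E) (A : E →L[ℝ] E)
    (hgA : HasStrictFDerivAt g A p) (hA : ∀ x y, inner ℝ (A x) y = inner ℝ x (A y))
    (l : ℝ) (hl : 1 < l) (v : E) (hv : v ≠ 0) (hAv : A v = l • v) :
    ∃ ρ > 0, μ {x | ∀ t : ℕ, g^[t] x ∈ Metric.closedBall p ρ} = 0 := by
  obtain ⟨σ, h1σ, hσl, ε, hε, hgrow⟩ := exists_growth A hA l hl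
  obtain ⟨s, hs, happ⟩ := hgA.approximates_deriv_on_nhds (c := ⟨ε, hε.le⟩) (Or.inr hε)
  obtain ⟨ρ, hρ, hρs⟩ := Metric.nhds_basis_closedBall.mem_iff.1 hs
  refine ⟨ρ, hρ, ?_⟩
  set S := {x | ∀ t : ℕ, g^[t] x ∈ Metric.closedBall p ρ} with hS
  have hclosed : IsClosed S := by
    rw [hS, Set.ofPred_forall]
    exact isClosed_iInter fun t => Metric.isClosed_closedBall.preimage (hg.iterate t)
  -- key: two points of S never differ by a nonzero multiple of v
  have key : ∀ x ∈ S, ∀ y ∈ S, ∀ c : ℝ, x - y = c • v → c = 0 := by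
    intro x hx y hy c hxy
    by_contra hc
    let w : ℕ → E := fun t => g^[t] x - g^[t] y
    let V : ℕ → ℝ := fun t => ‖A (w t)‖ ^ 2 - σ * ‖w t‖ ^ 2
    have hstep : ∀ t, σ * V t ≤ V (t + 1) := by
      intro t
      have h1 := happ _ (hρs (hx t)) _ (hρs (hy t))
      have h2 := hgrow (w t) (w (t + 1) - A (w t)) (by
        simp only [w, Function.iterate_succ_apply']
        exact h1)
      simpa [V] using h2
    have hV : ∀ t, σ ^ t * V 0 ≤ V t := by
      intro t
      induction t with
      | zero => simp
      | succ t ih =>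
        calc σ ^ (t + 1) * V 0 = σ * (σ ^ t * V 0) := by ring
          _ ≤ σ * V t := by gcongr
          _ ≤ _ := hstep t
    have hV0 : 0 < V 0 := by
      have : w 0 = c • v := by simpa [w] using hxy
      simp only [V, this, map_smul, hAv, norm_smul, mul_pow, Real.norm_eq_abs, sq_abs]
      have h1 : 0 < ‖v‖ ^ 2 := by positivity
      have h2 : 0 < c ^ 2 := by positivity
      have h3 : 0 < (l ^ 2 - σ) * (c ^ 2 * ‖v‖ ^ 2) := mul_pos (by linarith) (by positivity)
      nlinarith
    have hbd : ∀ t, V t ≤ (‖A‖ * (ρ + ρ)) ^ 2 := by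
      intro t
      have h1 : ‖w t‖ ≤ ρ + ρ := by
        have := dist_triangle_right (g^[t] x) (g^[t] y) p
        have hx' := Metric.mem_closedBall.1 (hx t)
        have hy' := Metric.mem_closedBall.1 (hy t)
        simp only [w, ← dist_eq_norm]
        linarith
      have h2 : ‖A (w t)‖ ≤ ‖A‖ * (ρ + ρ) := (A.le_opNorm _).trans (by gcongr)
      have h3 : ‖A (w t)‖ ^ 2 ≤ (‖A‖ * (ρ + ρ)) ^ 2 := by gcongr
      have h4 : 0 ≤ σ * ‖w t‖ ^ 2 := by positivity
      simp only [V]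
      linarith
    obtain ⟨t, ht⟩ := pow_unbounded_of_one_lt ((‖A‖ * (ρ + ρ)) ^ 2 / V 0) h1σ
    rw [div_lt_iff₀ hV0] at ht
    linarith [hV t, hbd t]
  refine Measure.addHaar_eq_zero_of_disjoint_translates μ
    (fun k : ℕ => ((1 : ℝ) / (k + 1)) • v) ?_ ?_ hclosed.measurableSet
  · refine (Metric.isBounded_closedBall (x := (0 : E)) (r := ‖v‖)).subset ?_
    rintro _ ⟨k, rfl⟩
    rw [mem_closedBall_zero_iff, norm_smul, Real.norm_of_nonneg (by positivity)]
    refine mul_le_of_le_one_left (norm_nonneg _) ?_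
    rw [div_le_one (by positivity)]
    simp
  · intro i j hij
    refine Set.disjoint_left.2 ?_
    rintro z hz hz'
    simp only [Set.singleton_add, Set.image_add_left, Set.mem_preimage] at hz hz'
    have := key _ hz _ hz' ((1 : ℝ) / (j + 1) - 1 / (i + 1)) (by rw [sub_smul]; abel)
    apply hij
    rw [sub_eq_zero] at this
    have h2 : ((j : ℝ) + 1) = i + 1 := by
      simpa using this
    exact_mod_cast (by linarith : (i : ℝ) = j)

/-- Preimages of null sets under a `C¹` map with a.e. nonsingular derivative are null. -/
lemma preimage_null (μ : Measure E) [μ.IsAddHaarMeasure] (g : E → E) (hg : ContDiff ℝ 1 g)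
    (hdet : μ {x | (fderiv ℝ g x).det = 0} = 0) (N : Set E) (hN : μ N = 0) :
    μ (g ⁻¹' N) = 0 := by
  obtain ⟨N', hNN', hN'm, hN'0⟩ := exists_measurable_superset_of_null hN
  have hsub : g ⁻¹' N ⊆ {x | (fderiv ℝ g x).det = 0} ∪
      (g ⁻¹' N' ∩ {x | (fderiv ℝ g x).det ≠ 0}) := by
    intro x hx
    by_cases h : (fderiv ℝ g x).det = 0
    · exact Or.inl h
    · exact Or.inr ⟨hNN' hx, h⟩
  refine measure_mono_null hsub (measure_union_null hdet ?_)
  refine measure_null_of_locally_null _ ?_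
  rintro x ⟨hx, hxd⟩
  have hst : HasStrictFDerivAt g
      (((fderiv ℝ g x).toContinuousLinearEquivOfDetNeZero hxd : E ≃L[ℝ] E) : E →L[ℝ] E) x := by
    rw [ContinuousLinearMap.coe_toContinuousLinearEquivOfDetNeZero]
    exact hg.contDiffAt.hasStrictFDerivAt one_ne_zero
  set U := (hst.toOpenPartialHomeomorph g).source with hU
  have hUo : IsOpen U := (hst.toOpenPartialHomeomorph g).open_source
  have hxU : x ∈ U := hst.mem_toOpenPartialHomeomorph_source
  have hinj : Set.InjOn g U := (hst.toOpenPartialHomeomorph g).injOn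
  have hcont : Continuous fun x => (fderiv ℝ g x).det :=
    ContinuousLinearMap.continuous_det.comp (hg.continuous_fderiv one_ne_zero)
  set T := g ⁻¹' N' ∩ {x | (fderiv ℝ g x).det ≠ 0} with hT
  have hTm : MeasurableSet T :=
    (hg.continuous.measurable hN'm).inter (isOpen_ne_fun hcont continuous_const).measurableSet
  refine ⟨T ∩ U, inter_mem self_mem_nhdsWithin (mem_nhdsWithin_of_mem_nhds (hUo.mem_nhds hxU)), ?_⟩
  have hm : MeasurableSet (T ∩ U) := hTm.inter hUo.measurableSet
  have hint := lintegral_abs_det_fderiv_eq_addHaar_image μ hm (f := g) (f' := fderiv ℝ g)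
    (fun y _ => (hg.differentiable one_ne_zero y).hasFDerivAt.hasFDerivWithinAt)
    (hinj.mono Set.inter_subset_right)
  have h0 : μ (g '' (T ∩ U)) = 0 := by
    refine measure_mono_null ?_ hN'0
    rintro _ ⟨y, hy, rfl⟩
    exact hy.1.1
  rw [h0] at hint
  rw [setLIntegral_eq_zero_iff hm hcont.abs.measurable.ennreal_ofReal] at hint
  rw [measure_eq_zero_iff_ae_notMem]
  filter_upwards [hint] with y hy hyT
  have := hy hyT
  rw [ENNReal.ofReal_eq_zero] at this
  exact hyT.1.2 (abs_nonpos_iff.1 this)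

end Helpers

section Armijo

variable {n : ℕ}

lemma contDiff_grad (f : EuclideanSpace ℝ (Fin n) → ℝ) (hf : ContDiff ℝ 2 f) :
    ContDiff ℝ 1 (gradient f) := by
  have h : ContDiff ℝ 1 (fderiv ℝ f) := hf.fderiv_right (by norm_num)
  exact (InnerProductSpace.toDual ℝ (EuclideanSpace ℝ (Fin n))).symm.contDiff.comp h

lemma inner_hess (f : EuclideanSpace ℝ (Fin n) → ℝ) (hf : ContDiff ℝ 2 f)
    (p x y : EuclideanSpace ℝ (Fin n)) :
    inner ℝ (fderiv ℝ (gradient f) p x) y = fderiv ℝ (fderiv ℝ f) p x y := by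
  have hG := (contDiff_grad f hf).differentiable one_ne_zero p
  have h1 : HasFDerivAt (fun z => inner ℝ (gradient f z) y)
      ((innerSL ℝ y) ∘L (fderiv ℝ (gradient f) p)) p := by
    have := ((innerSL ℝ y).hasFDerivAt (x := gradient f p)).comp p hG.hasFDerivAt
    refine this.congr_of_eventuallyEq (Eventually.of_forall fun z => ?_)
    simp
  have hf' : DifferentiableAt ℝ (fderiv ℝ f) p :=
    (hf.fderiv_right (m := 1) (by norm_num)).differentiable one_ne_zero p
  have h2 : HasFDerivAt (fun z => inner ℝ (gradient f z) y)
      ((fderiv ℝ (fderiv ℝ f) p).flip y) p := by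
    have := hf'.hasFDerivAt.clm_apply (hasFDerivAt_const y p)
    refine (this.congr_of_eventuallyEq (Eventually.of_forall fun z => ?_)).congr_fderiv ?_
    · change inner ℝ (gradient f z) y = fderiv ℝ f z y
      rw [← toDual_gradient, InnerProductSpace.toDual_apply_apply]
    · ext; simp
  have h3 := congrArg (fun L => L x) (h1.unique h2)
  simpa [real_inner_comm] using h3

lemma hess_symm (f : EuclideanSpace ℝ (Fin n) → ℝ) (hf : ContDiff ℝ 2 f)
    (p x y : EuclideanSpace ℝ (Fin n)) :
    inner ℝ (fderiv ℝ (gradient f) p x) y = inner ℝ x (fderiv ℝ (gradient f) p y) := by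
  rw [inner_hess f hf, real_inner_comm, inner_hess f hf]
  exact hf.contDiffAt.isSymmSndFDerivAt (by simp) x y

lemma armijo_local (f : EuclideanSpace ℝ (Fin n) → ℝ) (hf : ContDiff ℝ 2 f) (r : ℝ) (hr : r < 1)
    (p : EuclideanSpace ℝ (Fin n)) (hp : gradient f p = 0) :
    ∃ δ > 0, ∀ᶠ x in 𝓝 p, ∀ α, 0 ≤ α → α ≤ δ → ArmijoCond f r x α := by
  have hG := contDiff_grad f hf
  obtain ⟨K, t, ht, hL⟩ := (hG.contDiffAt (x := p)).exists_lipschitzOnWith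
  obtain ⟨ρ, hρ, hρt⟩ := Metric.mem_nhds_iff.1 ht
  have hK : (0 : ℝ) ≤ K := K.2
  refine ⟨min 1 ((1 - r) / (K + 1)), lt_min one_pos (div_pos (by linarith) (by positivity)), ?_⟩
  have hev : ∀ᶠ x in 𝓝 p, ‖gradient f x‖ < ρ / 2 := by
    have h1 : Tendsto (fun x => ‖gradient f x‖) (𝓝 p) (𝓝 ‖gradient f p‖) :=
      hG.continuous.norm.tendsto p
    rw [hp, norm_zero] at h1
    exact h1.eventually_lt_const (by positivity)
  filter_upwards [hev, Metric.ball_mem_nhds p (half_pos hρ)] with x hx1 hx2 α hα0 hαδ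
  have hα1 : α ≤ 1 := hαδ.trans (min_le_left _ _)
  have hαK : α * (K + 1) ≤ 1 - r := by
    have := hαδ.trans (min_le_right _ _)
    rwa [le_div_iff₀ (by positivity)] at this
  set γ := gradient f x with hγ
  set y := x - α • γ with hy
  have hyx : ‖y - x‖ = α * ‖γ‖ := by
    rw [hy, sub_sub_cancel_left, norm_neg, norm_smul, Real.norm_of_nonneg hα0]
  have hγ0 := norm_nonneg γ
  have hxb : x ∈ Metric.ball p ρ := Metric.ball_subset_ball (by linarith) hx2
  have hyb : y ∈ Metric.ball p ρ := by
    rw [Metric.mem_ball] at hx2 ⊢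
    have h1 := dist_triangle y x p
    rw [dist_eq_norm y x, hyx] at h1
    nlinarith
  have hmv := Convex.norm_image_sub_le_of_norm_hasFDerivWithin_le'
    (f := f) (f' := fderiv ℝ f) (φ := fderiv ℝ f x) (C := K * (α * ‖γ‖))
    (s := Metric.ball p ρ ∩ Metric.closedBall x (α * ‖γ‖)) (x := x) (y := y)
    (fun z _ => (hf.differentiable (by norm_num) z).hasFDerivAt.hasFDerivWithinAt)
    (fun z hz => by
      rw [← toDual_gradient, ← toDual_gradient, ← map_sub, LinearIsometryEquiv.norm_map,
        ← dist_eq_norm]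
      refine (hL.dist_le_mul z (hρt hz.1) x (hρt hxb)).trans ?_
      have := Metric.mem_closedBall.1 hz.2
      gcongr)
    ((convex_ball p ρ).inter (convex_closedBall x _))
    ⟨hxb, Metric.mem_closedBall_self (by positivity)⟩
    ⟨hyb, by rw [Metric.mem_closedBall, dist_eq_norm, hyx]⟩
  rw [hyx] at hmv
  have hder : fderiv ℝ f x (y - x) = - (α * ‖γ‖ ^ 2) := by
    rw [← toDual_gradient, ← hγ, InnerProductSpace.toDual_apply_apply, hy, sub_sub_cancel_left,
      inner_neg_right, inner_smul_right, real_inner_self_eq_norm_sq]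
  rw [hder, Real.norm_eq_abs] at hmv
  have h5 := (abs_le.1 hmv).2
  unfold ArmijoCond
  rw [← hγ, ← hy]
  have h6 : α * K ≤ 1 - r := by nlinarith
  have h7 : α * K * (α * ‖γ‖ ^ 2) ≤ (1 - r) * (α * ‖γ‖ ^ 2) := by gcongr
  nlinarith

lemma stabilizes (f : EuclideanSpace ℝ (Fin n) → ℝ) (hf : ContDiff ℝ 2 f)
    (τ r : ℝ) (hτ : τ ∈ Set.Ioo (0 : ℝ) 1) (hr : r < 1) (abar : ℝ) (habar : 0 < abar)
    (x : ℕ → EuclideanSpace ℝ (Fin n)) (a : ℕ → ℝ) (h : StabilizedArmijo f τ r abar x a)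
    (p : EuclideanSpace ℝ (Fin n)) (hp : gradient f p = 0) (hx : Tendsto x atTop (𝓝 p)) :
    ∃ m : ℕ → ℕ, (∀ t, x (t + 1) = x t - (τ ^ m t * abar) • gradient f (x t)) ∧
      ∃ T, ∀ t ≥ T, m t = m T := by
  obtain ⟨ha0, hstep⟩ := h
  choose k hk1 hk2 hk3 hk4 using hstep
  let M : ℕ → ℕ := fun t => ∑ i ∈ Finset.range t, k i
  have hM : ∀ t, a t = τ ^ M t * abar := by
    intro t
    induction t with
    | zero => simp [M, ha0]
    | succ t ih =>
      rw [hk1, ih, ← mul_assoc, ← pow_add]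
      simp [M, Finset.sum_range_succ, add_comm]
  have hMs : ∀ t, M (t + 1) = M t + k t := fun t => by simp [M, Finset.sum_range_succ]
  have hmono : Monotone M := monotone_nat_of_le_succ fun t => by rw [hMs]; omega
  have hpos : ∀ t, 0 < a t := fun t => by
    rw [hM]; exact mul_pos (pow_pos hτ.1 _) habar
  refine ⟨fun t => M (t + 1), fun t => by rw [← hM, hk4], ?_⟩
  suffices hs : ∃ T, ∀ t ≥ T, M t = M T by
    obtain ⟨T, hT⟩ := hs
    exact ⟨T, fun t ht => by
      change M (t + 1) = M (T + 1)
      rw [hT (t + 1) (by omega), hT (T + 1) (by omega)]⟩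
  obtain ⟨δ, hδ, hev⟩ := armijo_local f hf r hr p hp
  obtain ⟨T0, hT0⟩ := eventually_atTop.1 (hx.eventually hev)
  by_cases hc : ∃ T ≥ T0, a T ≤ δ
  · obtain ⟨T, hTT, haT⟩ := hc
    refine ⟨T, fun t ht => ?_⟩
    induction t, ht using Nat.le_induction with
    | base => rfl
    | succ t ht ih =>
      have hat : a t ≤ δ := by rw [hM, ih, ← hM]; exact haT
      have hk0 : k t = 0 := by
        by_contra hne
        refine hk3 t 0 (by omega) ?_
        rw [pow_zero, one_mul]
        exact hT0 t (by omega) _ (hpos t).le hat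
      rw [hMs, hk0, ih, add_zero]
  · push Not at hc
    have hbd : ∃ B, ∀ t, M t ≤ B := by
      obtain ⟨B, hB⟩ := exists_pow_lt_of_lt_one (div_pos hδ habar) hτ.2
      refine ⟨B, fun t => ?_⟩
      by_contra hlt
      push Not at hlt
      have h1 := hc (max t T0) (le_max_right _ _)
      rw [hM, ← div_lt_iff₀ habar] at h1
      have h2 : B ≤ M (max t T0) := hlt.le.trans (hmono (le_max_left _ _))
      have h3 := pow_le_pow_of_le_one hτ.1.le hτ.2.le h2
      linarith
    obtain ⟨B, hB⟩ := hbd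
    have hbdd : BddAbove (Set.range M) := ⟨B, by rintro _ ⟨t, rfl⟩; exact hB t⟩
    obtain ⟨T, hT⟩ := Nat.sSup_mem (Set.range_nonempty M) hbdd
    exact ⟨T, fun t ht => le_antisymm (hT ▸ le_csSup hbdd ⟨t, rfl⟩) (hmono ht)⟩

/-- The gradient step with step size `α`. -/
def gstep (f : EuclideanSpace ℝ (Fin n) → ℝ) (α : ℝ) (x : EuclideanSpace ℝ (Fin n)) :
    EuclideanSpace ℝ (Fin n) := x - α • gradient f x

lemma contDiff_gstep (f : EuclideanSpace ℝ (Fin n) → ℝ) (hf : ContDiff ℝ 2 f) (α : ℝ) :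
    ContDiff ℝ 1 (gstep f α) :=
  contDiff_id.sub ((contDiff_grad f hf).const_smul α)

lemma fderiv_gstep (f : EuclideanSpace ℝ (Fin n) → ℝ) (hf : ContDiff ℝ 2 f) (α : ℝ)
    (x : EuclideanSpace ℝ (Fin n)) :
    fderiv ℝ (gstep f α) x = ContinuousLinearMap.id ℝ _ - α • fderiv ℝ (gradient f) x :=
  ((hasFDerivAt_id x).sub
    (((contDiff_grad f hf).differentiable one_ne_zero x).hasFDerivAt.const_smul α)).fderiv

/-- Points from which fixed-step gradient descent converges to a strict saddle. -/
lemma fixed_step_null (f : EuclideanSpace ℝ (Fin n) → ℝ) (hf : ContDiff ℝ 2 f) (α : ℝ) (hα : 0 < α)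
    (hdet : volume {x | (fderiv ℝ (gstep f α) x).det = 0} = 0) :
    volume {x | ∃ p, IsStrictSaddle f p ∧ Tendsto (fun t => (gstep f α)^[t] x) atTop (𝓝 p)} = 0 := by
  have hg := contDiff_gstep f hf α
  have hloc : ∀ p, ∃ ρ > 0, IsStrictSaddle f p →
      volume {x | ∀ t : ℕ, (gstep f α)^[t] x ∈ Metric.closedBall p ρ} = 0 := by
    intro p
    by_cases hp : IsStrictSaddle f p
    · obtain ⟨-, μ, hμ, v, hv, hHv⟩ := hp
      obtain ⟨ρ, hρ, h⟩ := exists_null_local volume (gstep f α) hg.continuous p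
        (fderiv ℝ (gstep f α) p) (hg.contDiffAt.hasStrictFDerivAt one_ne_zero)
        (fun x y => by
          rw [fderiv_gstep f hf]
          simp [inner_sub_left, inner_sub_right, inner_smul_left, inner_smul_right,
            hess_symm f hf p x y])
        (1 - α * μ) (by nlinarith) v hv (by
          rw [fderiv_gstep f hf]
          simp [hHv, sub_smul, mul_smul])
      exact ⟨ρ, hρ, fun _ => h⟩
    · exact ⟨1, one_pos, fun h => absurd h hp⟩
  choose ρ hρ hnull using hloc
  obtain ⟨D, hDs, hDc, hD⟩ := TopologicalSpace.countable_cover_nhdsWithin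
    (s := {p | IsStrictSaddle f p}) (f := fun p => Metric.ball p (ρ p))
    (fun p _ => mem_nhdsWithin_of_mem_nhds (Metric.ball_mem_nhds p (hρ p)))
  have hit : ∀ (T : ℕ) (N : Set (EuclideanSpace ℝ (Fin n))), volume N = 0 →
      volume ((gstep f α)^[T] ⁻¹' N) = 0 := by
    intro T
    induction T with
    | zero => intro N hN; simpa using hN
    | succ T ih =>
      intro N hN
      rw [Function.iterate_succ', Set.preimage_comp]
      exact ih _ (preimage_null volume _ hg hdet N hN)
  refine measure_mono_null (t := ⋃ p ∈ D, ⋃ T : ℕ, (gstep f α)^[T] ⁻¹'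
    {x | ∀ t : ℕ, (gstep f α)^[t] x ∈ Metric.closedBall p (ρ p)}) ?_ ?_
  · rintro x ⟨p, hp, hx⟩
    obtain ⟨q, hq, hpq⟩ := Set.mem_iUnion₂.1 (hD hp)
    obtain ⟨T, hT⟩ := eventually_atTop.1 (hx.eventually (Metric.isOpen_ball.mem_nhds hpq))
    refine Set.mem_iUnion₂.2 ⟨q, hq, Set.mem_iUnion.2 ⟨T, fun t => ?_⟩⟩
    rw [← Function.iterate_add_apply]
    exact Metric.ball_subset_closedBall (hT (t + T) (by omega))
  · rw [measure_biUnion_null_iff hDc]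
    intro p hp
    rw [measure_iUnion_null_iff]
    exact fun T => hit T _ (hnull p (hDs hp))

lemma ae_det (f : EuclideanSpace ℝ (Fin n) → ℝ) (hf : ContDiff ℝ 2 f) (c : ℝ) (hc : c ≠ 0) :
    ∀ᵐ abar ∂(volume : Measure ℝ),
      volume {x | (fderiv ℝ (gstep f (c * abar)) x).det = 0} = 0 := by
  have hcont : Continuous fun z : ℝ × EuclideanSpace ℝ (Fin n) =>
      (fderiv ℝ (gstep f (c * z.1)) z.2).det := by
    simp_rw [fderiv_gstep f hf]
    have := (contDiff_grad f hf).continuous_fderiv one_ne_zero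
    exact ContinuousLinearMap.continuous_det.comp (by fun_prop)
  have key : ∀ᵐ abar ∂(volume : Measure ℝ), ∀ᵐ x ∂(volume : Measure (EuclideanSpace ℝ (Fin n))),
      (fderiv ℝ (gstep f (c * abar)) x).det ≠ 0 := by
    rw [Measure.ae_ae_comm (isOpen_ne_fun hcont continuous_const).measurableSet]
    refine Eventually.of_forall fun x => ?_
    have hfin : {s : ℝ | (fderiv ℝ (gstep f (c * s)) x).det = 0}.Finite := by
      refine Set.Finite.subset ((finite_eigs (fderiv ℝ (gradient f) x)).preimage
        (f := fun s : ℝ => (c * s)⁻¹) ?_) ?_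
      · intro s _ t _ hst
        exact mul_left_cancel₀ hc (inv_injective hst)
      · intro s hs
        obtain ⟨v, hv, h⟩ := exists_ker_of_det _ hs
        rw [fderiv_gstep f hf] at h
        have h1 : v = (c * s) • fderiv ℝ (gradient f) x v := by
          simpa [sub_eq_zero] using h
        refine ⟨v, hv, ?_⟩
        have hne : c * s ≠ 0 := by
          intro h0
          rw [h0, zero_smul] at h1
          exact hv h1
        change _ = (c * s)⁻¹ • v
        conv_rhs => rw [h1]
        rw [inv_smul_smul₀ hne]
    have := hfin.measure_zero (volume : Measure ℝ)
    rw [measure_eq_zero_iff_ae_notMem] at this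
    exact this
  filter_upwards [key] with abar h
  simpa [ae_iff] using h

end Armijo

/-- For a `C²` function `f : ℝⁿ → ℝ`, parameters `τ, r ∈ (0,1)`, and almost every initial
step size `ᾱ > 0`, stabilized Armijo backtracking gradient descent avoids the strict
saddles of `f`: the set of initial points whose generated sequence converges to a strict
saddle of `f` has Lebesgue measure zero. -/
theorem stabilized_armijo_avoids_strict_saddles {n : ℕ}
    (f : EuclideanSpace ℝ (Fin n) → ℝ) (hf : ContDiff ℝ 2 f)
    (τ r : ℝ) (hτ : τ ∈ Set.Ioo (0 : ℝ) 1) (hr : r ∈ Set.Ioo (0 : ℝ) 1) :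
    ∀ᵐ abar ∂(volume : Measure ℝ), 0 < abar →
      volume {x₀ : EuclideanSpace ℝ (Fin n) |
        ∃ x : ℕ → EuclideanSpace ℝ (Fin n), ∃ a : ℕ → ℝ,
          x 0 = x₀ ∧ StabilizedArmijo f τ r abar x a ∧
          ∃ p, IsStrictSaddle f p ∧ Tendsto x atTop (𝓝 p)} = 0 := by
  have hall : ∀ᵐ abar ∂(volume : Measure ℝ), ∀ m : ℕ,
      volume {x | (fderiv ℝ (gstep f (τ ^ m * abar)) x).det = 0} = 0 :=
    ae_all_iff.2 fun m => ae_det f hf (τ ^ m) (pow_ne_zero _ hτ.1.ne')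
  filter_upwards [hall] with abar hdet habar
  have hpos : ∀ m : ℕ, 0 < τ ^ m * abar := fun m => mul_pos (pow_pos hτ.1 _) habar
  let g : ℕ → EuclideanSpace ℝ (Fin n) → EuclideanSpace ℝ (Fin n) :=
    fun m => gstep f (τ ^ m * abar)
  let W : Set (EuclideanSpace ℝ (Fin n)) :=
    ⋃ m : ℕ, {x | ∃ p, IsStrictSaddle f p ∧ Tendsto (fun t => (g m)^[t] x) atTop (𝓝 p)}
  have hW : volume W = 0 :=
    measure_iUnion_null fun m => fixed_step_null f hf _ (hpos m) (hdet m)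
  let R : ℕ → Set (EuclideanSpace ℝ (Fin n)) := fun T =>
    Nat.rec W (fun _ N => ⋃ m : ℕ, g m ⁻¹' N) T
  have hR : ∀ T, volume (R T) = 0 := by
    intro T
    induction T with
    | zero => exact hW
    | succ T ih =>
      exact measure_iUnion_null fun m =>
        preimage_null volume _ (contDiff_gstep f hf _) (hdet m) _ ih
  have hback : ∀ (T : ℕ) (x : ℕ → EuclideanSpace ℝ (Fin n)),
      (∀ t, ∃ m, x (t + 1) = g m (x t)) → x T ∈ W → x 0 ∈ R T := by
    intro T
    induction T with
    | zero => intro x _ hx; exact hx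
    | succ T ih =>
      intro x hx hxT
      have h1 := ih (fun t => x (t + 1)) (fun t => hx (t + 1)) hxT
      obtain ⟨m, hm⟩ := hx 0
      refine Set.mem_iUnion.2 ⟨m, ?_⟩
      rw [Set.mem_preimage, ← hm]
      exact h1
  refine measure_mono_null (t := ⋃ T, R T) ?_ (measure_iUnion_null hR)
  rintro x₀ ⟨x, a, rfl, hxa, p, hp, hxp⟩
  obtain ⟨m, hm, T, hT⟩ := stabilizes f hf τ r hτ hr.2 abar habar x a hxa p hp.1 hxp
  refine Set.mem_iUnion.2 ⟨T, hback T x (fun t => ⟨m t, hm t⟩) ?_⟩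
  refine Set.mem_iUnion.2 ⟨m T, p, hp, ?_⟩
  have hiter : ∀ t, (g (m T))^[t] (x T) = x (t + T) := by
    intro t
    induction t with
    | zero => simp
    | succ t ih =>
      rw [Function.iterate_succ_apply', ih, Nat.add_right_comm, hm, hT (t + T) (by omega)]
      rfl
  simp_rw [hiter]
  exact (tendsto_add_atTop_iff_nat T).2 hxp
end
end
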